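/- arXiv:2601.14332 — 2 statements merged into one kernel-verified Lean document; each statement's English description precedes it below -/
import Mathlib

section
/- Let D be a bounded convex domain in ℝ^d with Lebesgue measure. For each δ > 0 let 0 < c₁(δ) ≤ c₂(δ) and set D_δ := { ρ ∈ L¹(D) : ρ ≥ 0, ∫_D ρ dx = 1, and c₁(δ) ≤ ρ ≤ c₂(δ) a.e. }, and let D := ∪_{δ>0} D_δ. Suppose for each δ > 0 we are given a map P_δ from the set of Borel probability measures P(D̄) into D_δ (each ρ ∈ D being identified with the measure ρ dx) such that: (i) P_δ maps D_{δ̄} into D_{δ̄} for every δ̄ > 0; (ii) for every ρ ∈ D and every sequence of positive numbers tending to 0 there is a subsequence δ_k → 0 along which P_{δ_k}ρ → ρ a.e. in D. Let J : D → (−∞, ∞] satisfy: for each δ > 0 and each sequence ρ_n in D_δ converging a.e. to some ρ ∈ D_δ one has liminf_{n→∞} J(ρ_n) ≤ J(ρ). Define J_δ : P(D̄) → (−∞, ∞] by J_δ(μ) := J(P_δ μ), and assume that each J_δ admits a minimizer μ_δ ∈ P(D̄). Then there exists a sequence δ_k → 0 such that lim_{k→∞} J_{δ_k}(μ_{δ_k})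 = inf_{D} J. -/
open MeasureTheory Filter Topology

/-- A lower bound `a` of a sequence `u` which `u` approaches frequently from above is the limit
of a subsequence of `u`. -/
theorem exists_strictMono_tendsto_of_frequently_lt {α : Type*} [LinearOrder α]
    [TopologicalSpace α] [OrderTopology α] [FirstCountableTopology α] {u : ℕ → α} {a : α}
    (hle : ∀ n, a ≤ u n) (hlt : ∀ b, a < b → ∃ᶠ n in atTop, u n < b) :
    ∃ ψ : ℕ → ℕ, StrictMono ψ ∧ Tendsto (u ∘ ψ) atTop (𝓝 a) := by
  refine MapClusterPt.tendsto_subseq ?_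
  rw [mapClusterPt_iff_frequently]
  intro t ht
  by_cases hmax : ∃ b, a < b
  · obtain ⟨b, hb, hsub⟩ := exists_Ico_subset_of_mem_nhds ht hmax
    exact (hlt b hb).mono fun n hn => hsub ⟨hle n, hn⟩
  · push Not at hmax
    refine Frequently.of_forall fun n => ?_
    rw [(hmax (u n)).antisymm (hle n)]
    exact mem_of_mem_nhds ht

/-- A nonnegative integrable function of integral one is the density of a probability measure. -/
theorem isProbabilityMeasure_withDensity_ofReal {α : Type*} [MeasurableSpace α] {μ : Measure α}
    {ρ : α → ℝ} (hint : Integrable ρ μ) (hnonneg : 0 ≤ᵐ[μ] ρ) (hone : ∫ x, ρ x ∂μ = 1) :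
    IsProbabilityMeasure (μ.withDensity fun x => ENNReal.ofReal (ρ x)) := by
  constructor
  rw [withDensity_apply _ MeasurableSet.univ, Measure.restrict_univ,
    ← ofReal_integral_eq_lintegral_ofReal hint hnonneg, hone, ENNReal.ofReal_one]

/-- A measure with a density with respect to the restriction to `D` does not charge the
complement of the closure of `D`. -/
theorem withDensity_restrict_compl_closure {α : Type*} [TopologicalSpace α] [MeasurableSpace α]
    [OpensMeasurableSpace α] (μ : Measure α) (D : Set α) (f : α → ENNReal) :
    (μ.restrict D).withDensity f (closure D)ᶜ = 0 := by
  refine withDensity_absolutelyContinuous _ _ ?_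
  rw [Measure.restrict_apply isClosed_closure.measurableSet.compl,
    (Set.disjoint_compl_left_iff_subset.2 subset_closure).inter_eq, measure_empty]

/-- If `P_δ` is a smoothing family mapping probability measures on `D̄`
into the admissible density class `D_δ`, preserving each `D_δ̄`, and approximating
the identity along subsequences (a.e. convergence), and if `J` is sequentially
"liminf-bounded" on each `D_δ` with respect to a.e. convergence, and each relaxed
functional `J_δ = J ∘ P_δ` admits a minimizer `μ_δ`, then there exists a sequence
`δ_k → 0` with `J_{δ_k}(μ_{δ_k}) → inf_𝒟 J`. -/
theorem relaxed_minimizers_approximate_infimum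
    {d : ℕ} (D : Set (EuclideanSpace ℝ (Fin d)))
    (hD_open : IsOpen D) (hD_ne : D.Nonempty) (hD_conv : Convex ℝ D)
    (hD_bdd : Bornology.IsBounded D)
    (c₁ c₂ : ℝ → ℝ) (hc : ∀ δ > (0 : ℝ), 0 < c₁ δ ∧ c₁ δ ≤ c₂ δ)
    -- the admissible density classes `D_δ` and `𝒟 = ⋃_{δ>0} D_δ`
    (Dset : ℝ → Set (EuclideanSpace ℝ (Fin d) → ℝ))
    (hDset : ∀ δ, Dset δ =
      {ρ | IntegrableOn ρ D ∧ (∀ᵐ x ∂(volume.restrict D), 0 ≤ ρ x) ∧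
        (∫ x in D, ρ x) = 1 ∧
        (∀ᵐ x ∂(volume.restrict D), c₁ δ ≤ ρ x ∧ ρ x ≤ c₂ δ)})
    (𝒟 : Set (EuclideanSpace ℝ (Fin d) → ℝ))
    (h𝒟 : 𝒟 = ⋃ δ > (0 : ℝ), Dset δ)
    -- identification of a density `ρ ∈ 𝒟` with the measure `ρ dx`
    (mOf : (EuclideanSpace ℝ (Fin d) → ℝ) → Measure (EuclideanSpace ℝ (Fin d)))
    (hmOf : ∀ ρ, mOf ρ = (volume.restrict D).withDensity (fun x => ENNReal.ofReal (ρ x)))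
    -- the smoothing maps `P_δ : P(D̄) → D_δ`
    (P : ℝ → Measure (EuclideanSpace ℝ (Fin d)) → (EuclideanSpace ℝ (Fin d) → ℝ))
    (hPrange : ∀ δ > (0 : ℝ), ∀ μ : Measure (EuclideanSpace ℝ (Fin d)),
      IsProbabilityMeasure μ → μ (closure D)ᶜ = 0 → P δ μ ∈ Dset δ)
    -- (i) `P_δ` maps `D_δ̄` into `D_δ̄`
    (hPinv : ∀ δ > (0 : ℝ), ∀ δ' > (0 : ℝ), ∀ ρ ∈ Dset δ', P δ (mOf ρ) ∈ Dset δ')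
    -- (ii) approximation of the identity along subsequences, a.e. in `D`
    (hPapprox : ∀ ρ ∈ 𝒟, ∀ s : ℕ → ℝ, (∀ n, 0 < s n) → Tendsto s atTop (𝓝 0) →
      ∃ φ : ℕ → ℕ, StrictMono φ ∧
        ∀ᵐ x ∂(volume.restrict D),
          Tendsto (fun j => P (s (φ j)) (mOf ρ) x) atTop (𝓝 (ρ x)))
    -- the objective functional and the liminf property on each `D_δ`
    (J : (EuclideanSpace ℝ (Fin d) → ℝ) → EReal)
    (hJ : ∀ δ > (0 : ℝ), ∀ ρn : ℕ → (EuclideanSpace ℝ (Fin d) → ℝ),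
      ∀ ρ : EuclideanSpace ℝ (Fin d) → ℝ, (∀ n, ρn n ∈ Dset δ) → ρ ∈ Dset δ →
      (∀ᵐ x ∂(volume.restrict D), Tendsto (fun n => ρn n x) atTop (𝓝 (ρ x))) →
      Filter.liminf (fun n => J (ρn n)) atTop ≤ J ρ)
    -- minimizers `μ_δ` of `J_δ = J ∘ P_δ`
    (μmin : ℝ → Measure (EuclideanSpace ℝ (Fin d)))
    (hμmin : ∀ δ > (0 : ℝ), IsProbabilityMeasure (μmin δ) ∧ (μmin δ) (closure D)ᶜ = 0 ∧
      ∀ ν : Measure (EuclideanSpace ℝ (Fin d)),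
        IsProbabilityMeasure ν → ν (closure D)ᶜ = 0 →
        J (P δ (μmin δ)) ≤ J (P δ ν)) :
    ∃ s : ℕ → ℝ, (∀ k, 0 < s k) ∧ Tendsto s atTop (𝓝 0) ∧
      Tendsto (fun k => J (P (s k) (μmin (s k)))) atTop (𝓝 (⨅ ρ ∈ 𝒟, J ρ)) := by
  have mem_iff : ∀ ρ, ρ ∈ 𝒟 ↔ ∃ δ > (0 : ℝ), ρ ∈ Dset δ := by simp [h𝒟]
  set s : ℕ → ℝ := fun n => 1 / ((n : ℝ) + 1)
  have hs_pos : ∀ n, 0 < s n := fun n => Nat.one_div_pos_of_nat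
  have hs_lim : Tendsto s atTop (𝓝 0) := tendsto_one_div_add_atTop_nhds_zero_nat
  have hle : ∀ n, ⨅ ρ ∈ 𝒟, J ρ ≤ J (P (s n) (μmin (s n))) := fun n =>
    iInf₂_le _ <| (mem_iff _).2 ⟨s n, hs_pos n,
      hPrange _ (hs_pos n) _ (hμmin _ (hs_pos n)).1 (hμmin _ (hs_pos n)).2.1⟩
  have hlt : ∀ b, ⨅ ρ ∈ 𝒟, J ρ < b → ∃ᶠ n in atTop, J (P (s n) (μmin (s n))) < b := by
    intro b hb
    obtain ⟨ρ, hρ, hρb⟩ : ∃ ρ ∈ 𝒟, J ρ < b := by simpa [iInf_lt_iff] using hb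
    obtain ⟨δ, hδ, hρδ⟩ := (mem_iff ρ).1 hρ
    obtain ⟨φ, hφ, hlim⟩ := hPapprox ρ hρ s hs_pos hs_lim
    have hliminf := hJ δ hδ _ ρ (fun j => hPinv _ (hs_pos (φ j)) δ hδ ρ hρδ) hρδ hlim
    have hfreq := frequently_lt_of_liminf_lt (by isBoundedDefault) (hliminf.trans_lt hρb)
    obtain ⟨hint, hnonneg, hone, -⟩ : ρ ∈ {ρ | _} := hDset δ ▸ hρδ
    refine hφ.tendsto_atTop.frequently (hfreq.mono fun j hj => ?_)
    refine ((hμmin _ (hs_pos (φ j))).2.2 (mOf ρ) ?_ ?_).trans_lt hj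
    · rw [hmOf]
      exact isProbabilityMeasure_withDensity_ofReal hint hnonneg hone
    · rw [hmOf]
      exact withDensity_restrict_compl_closure _ _ _
  obtain ⟨ψ, hψ, hlim⟩ := exists_strictMono_tendsto_of_frequently_lt hle hlt
  exact ⟨s ∘ ψ, fun k => hs_pos _, hs_lim.comp hψ.tendsto_atTop, hlim⟩
end

section
/- Let α ∈ (0,1), A ≥ 1, and η ∈ (0,1]. Let N₀, N₁, N₂, H_α, F₀, F_α be nonnegative real numbers satisfying: (i) N₀ ≤ η F₀ and F₀ ≤ F_α; (ii) N₂ ≤ A ( N₀ + F_α + η⁻¹ ( N₀ + H_α ) ); (iii) H_α ≤ A θ^{−α/(1−α)} N₀ + θ N₁ for every θ > 0; (iv) N₁ ≤ A θ'⁻¹ N₀ + θ' N₂ for every θ' > 0. Then there exists a constant C depending only on A and α (and not on η or the N's and F's) such that N₁ ≤ C η^{(1−α)/(2−α)} F_α. -/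
open MeasureTheory Filter Topology

/-- The quantitative core of the filtered-sensitivity estimate:
from the maximum principle bound (i), the Schauder estimate (ii), and the
interpolation inequalities (iii)–(iv), one deduces
`N₁ ≤ C η^{(1−α)/(2−α)} F_α` with `C = C(A, α)` independent of `η`. -/
theorem schauder_interpolation_eta_estimate
    (α A : ℝ) (hα : 0 < α) (hα1 : α < 1) (hA : 1 ≤ A) :
    ∃ C : ℝ, ∀ η N₀ N₁ N₂ Hα F₀ Fα : ℝ,
      0 < η → η ≤ 1 →
      0 ≤ N₀ → 0 ≤ N₁ → 0 ≤ N₂ → 0 ≤ Hα → 0 ≤ F₀ → 0 ≤ Fα →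
      -- (i) maximum principle
      N₀ ≤ η * F₀ → F₀ ≤ Fα →
      -- (ii) Schauder estimate
      N₂ ≤ A * (N₀ + Fα + η⁻¹ * (N₀ + Hα)) →
      -- (iii) interpolation for the Hölder seminorm
      (∀ θ : ℝ, 0 < θ → Hα ≤ A * θ ^ (-(α / (1 - α))) * N₀ + θ * N₁) →
      -- (iv) interpolation for the C¹ norm
      (∀ θ' : ℝ, 0 < θ' → N₁ ≤ A * θ'⁻¹ * N₀ + θ' * N₂) →
      N₁ ≤ C * η ^ ((1 - α) / (2 - α)) * Fα := by
  refine ⟨8 * A + 2 * A ^ 2 * (2 * A) ^ (α / (1 - α)), ?_⟩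
  intro η N₀ N₁ N₂ Hα F₀ Fα hη hη1 _ _ _ _ _ hF hN₀ hF₀ hN₂ hH hN₁
  have hA0 : 0 < A := by linarith
  have h2α : 0 < 2 - α := by linarith
  have h1α : 0 < 1 - α := by linarith
  set K := (2 * A) ^ (α / (1 - α))
  set x := η ^ ((1 - α) / (2 - α)) with hx
  set t := η ^ (1 / (2 - α)) with ht
  have hx0 : 0 < x := Real.rpow_pos_of_pos hη _
  have ht0 : 0 < t := Real.rpow_pos_of_pos hη _
  have htx : t * x = η := by
    rw [hx, ht, ← Real.rpow_add hη,
      show 1 / (2 - α) + (1 - α) / (2 - α) = 1 by field_simp; ring, Real.rpow_one]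
  have htlex : t ≤ x := by
    apply Real.rpow_le_rpow_of_exponent_ge hη hη1
    gcongr
    linarith
  have hθ : (x / (2 * A)) ^ (-(α / (1 - α))) = x ^ (-(α / (1 - α))) * K := by
    rw [Real.div_rpow hx0.le (by positivity), Real.rpow_neg (by positivity : 0 ≤ 2 * A),
      div_inv_eq_mul]
  have htθ : t * x ^ (-(α / (1 - α))) = x := by
    rw [hx, ht, ← Real.rpow_mul hη.le, ← Real.rpow_add hη]
    congr 1
    field_simp
    ring
  have hN₀F : N₀ ≤ η * Fα := hN₀.trans (by gcongr)
  have hN₀F' : N₀ ≤ Fα := hN₀F.trans (mul_le_of_le_one_left hF hη1)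
  have hηN₀ : η⁻¹ * N₀ ≤ Fα := (inv_mul_le_iff₀ hη).2 hN₀F
  have hHbound := hH (x / (2 * A)) (by positivity)
  have htη : t * η⁻¹ = x⁻¹ := by
    rw [← htx]
    field_simp
  have hfirst : A * t⁻¹ * N₀ ≤ A * x * Fα := by
    calc A * t⁻¹ * N₀ ≤ A * t⁻¹ * (η * Fα) := by gcongr
      _ = A * x * Fα := by rw [← htx]; field_simp
  have hlower : t * (A * (N₀ + Fα + η⁻¹ * N₀)) ≤ 3 * A * x * Fα := by
    calc t * (A * (N₀ + Fα + η⁻¹ * N₀)) ≤ x * (A * (Fα + Fα + Fα)) := by gcongr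
      _ = 3 * A * x * Fα := by ring
  have hholder : A * (t * η⁻¹) * Hα ≤ A ^ 2 * K * x * Fα + N₁ / 2 := by
    calc A * (t * η⁻¹) * Hα
        ≤ A * (t * η⁻¹) * (A * (x / (2 * A)) ^ (-(α / (1 - α))) * (η * Fα)
            + x / (2 * A) * N₁) := by
          gcongr
          exact hHbound.trans (by gcongr)
      _ = A ^ 2 * K * (t * x ^ (-(α / (1 - α)))) * Fα + A * (t * η⁻¹) * (x / (2 * A)) * N₁ := by
          rw [hθ]
          field_simp
      _ = A ^ 2 * K * x * Fα + N₁ / 2 := by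
          rw [htθ, htη]
          field_simp
  have hsplit : N₁ ≤ A * t⁻¹ * N₀ + (t * (A * (N₀ + Fα + η⁻¹ * N₀)) + A * (t * η⁻¹) * Hα) := by
    calc N₁ ≤ A * t⁻¹ * N₀ + t * N₂ := hN₁ t ht0
      _ ≤ A * t⁻¹ * N₀ + t * (A * (N₀ + Fα + η⁻¹ * (N₀ + Hα))) := by gcongr
      _ = _ := by ring
  linarith
end
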